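/- For any finitely presented group, the minimum isoperimetric function P_min, minimum filling length function F_min, and minimum isodiametric function D_min of a fixed finite presentation satisfy: D_min(n) ≤ F_min(n)/2 and F_min(n) ≤ c·(P_min(n) + n) for some constant c > 1 depending only on the presentation. -/

import Mathlib

/-- `w` represents the identity of the group presented by `⟨A;R⟩`. -/
def WordTrivial {α : Type*} (R : Finset (List (α × Bool))) (w : List (α × Bool)) : Prop :=
  FreeGroup.mk w ∈ Subgroup.normalClosure (FreeGroup.mk '' (R : Set (List (α × Bool))))

/-- One step of the symmetric rewriting system `U_R ∪ U_FG` applied to a factor. -/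
def RwStep {α : Type*} (R : Finset (List (α × Bool))) (x y : List (α × Bool)) : Prop :=
  (∃ p u v q, x = p ++ u ++ q ∧ y = p ++ v ++ q ∧
      (u ++ FreeGroup.invRev v ∈ R ∨ FreeGroup.invRev (u ++ FreeGroup.invRev v) ∈ R)) ∨
  (∃ p q, ∃ (a : α) (b : Bool),
      (x = p ++ q ∧ y = p ++ (a, b) :: (a, !b) :: q) ∨
      (x = p ++ (a, b) :: (a, !b) :: q ∧ y = p ++ q))

/-- `w` can be rewritten to the empty word via `U_R ∪ U_FG` with all intermediate words of
length at most `bound`. -/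
def RwSeqTo1 {α : Type*} (R : Finset (List (α × Bool))) (bound : ℕ)
    (w : List (α × Bool)) : Prop :=
  ∃ ws : List (List (α × Bool)),
    List.Chain' (RwStep R) (w :: ws) ∧
    (w :: ws).getLast (List.cons_ne_nil w ws) = [] ∧
    ∀ v ∈ w :: ws, v.length ≤ bound

/-- The minimum isoperimetric function of `⟨A;R⟩`. -/
noncomputable def Pmin {α : Type*} (R : Finset (List (α × Bool))) (n : ℕ) : ℕ :=
  sInf {N | ∀ w : List (α × Bool), w.length ≤ n → WordTrivial R w →
    ∃ L : List (List (α × Bool) × List (α × Bool)),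
      (∀ p ∈ L, p.1 ∈ R ∨ FreeGroup.invRev p.1 ∈ R) ∧ L.length ≤ N ∧
      FreeGroup.mk w = (L.map fun p =>
        (FreeGroup.mk p.2)⁻¹ * FreeGroup.mk p.1 * FreeGroup.mk p.2).prod}

/-- The minimum filling length function of `⟨A;R⟩`. -/
noncomputable def Fmin {α : Type*} (R : Finset (List (α × Bool))) (n : ℕ) : ℕ :=
  sInf {L | ∀ w : List (α × Bool), w.length ≤ n → WordTrivial R w → RwSeqTo1 R L w}

/-- The minimum isodiametric function of `⟨A;R⟩`. -/
noncomputable def Dmin {α : Type*} (R : Finset (List (α × Bool))) (n : ℕ) : ℕ :=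
  sInf {D | ∀ w : List (α × Bool), w.length ≤ n → WordTrivial R w →
    ∃ L : List (List (α × Bool) × List (α × Bool)),
      (∀ p ∈ L, (p.1 ∈ R ∨ FreeGroup.invRev p.1 ∈ R) ∧ p.2.length ≤ D) ∧
      FreeGroup.mk w = (L.map fun p =>
        (FreeGroup.mk p.2)⁻¹ * FreeGroup.mk p.1 * FreeGroup.mk p.2).prod}

open FreeGroup

namespace FillingProof

variable {α : Type}

/-- inverse letter -/
def iv (a : α × Bool) : α × Bool := (a.1, !a.2)

theorem iv_iv (a : α × Bool) : iv (iv a) = a := by simp [iv]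

theorem invRev_cons' (a : α × Bool) (s : List (α × Bool)) :
    invRev (a :: s) = invRev s ++ [iv a] := by simp [invRev, iv]

theorem invRev_append' (s t : List (α × Bool)) :
    invRev (s ++ t) = invRev t ++ invRev s := by simp [invRev]

/-- Diagram predicate: `Dia C N w` says `w` bounds a disc diagram with at most `N` faces. -/
inductive Dia (C : Set (List (α × Bool))) : ℕ → List (α × Bool) → Prop
  | nil (N : ℕ) : Dia C N []
  | br (N1 N2 : ℕ) (a : α × Bool) (u v : List (α × Bool)) :
      Dia C N1 u → Dia C N2 v → Dia C (N1 + N2) (a :: (u ++ iv a :: v))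
  | face (N : ℕ) (a : α × Bool) (s w : List (α × Bool)) :
      a :: s ∈ C → Dia C N (invRev s ++ w) → Dia C (N + 1) (a :: w)

variable {C : Set (List (α × Bool))}

theorem Dia.mono {N : ℕ} {w : List (α × Bool)} (h : Dia C N w) :
    ∀ {M : ℕ}, N ≤ M → Dia C M w := by
  induction h with
  | nil N => intro M _; exact Dia.nil M
  | br N1 N2 a u v hu hv ihu ihv =>
    intro M hM
    have := Dia.br N1 (M - N1) a u v hu (ihv (by omega))
    rwa [show N1 + (M - N1) = M by omega] at this
  | face N a s w hC h ih =>
    intro M hM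
    obtain ⟨K, rfl⟩ : ∃ K, M = K + 1 := ⟨M - 1, by omega⟩
    exact Dia.face K a s w hC (ih (by omega))

theorem Dia.concat {N : ℕ} {w : List (α × Bool)} (h : Dia C N w) {K : ℕ}
    {y : List (α × Bool)} (hy : Dia C K y) : Dia C (N + K) (w ++ y) := by
  induction h with
  | nil N => exact hy.mono (by omega)
  | br N1 N2 a u v hu hv ihu ihv =>
    have := Dia.br N1 (N2 + K) a u (v ++ y) hu ihv
    simpa [add_assoc] using this
  | face N a s w hC h ih =>
    have := Dia.face (N + K) a s (w ++ y) hC (by simpa using ih)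
    simpa [add_assoc, add_comm, add_left_comm] using this

theorem split1 {β : Type} {c : β} {u v x y : List β} (h : u ++ c :: v = x ++ y) :
    (∃ z, x = u ++ c :: z ∧ v = z ++ y) ∨ (∃ z, u = x ++ z ∧ y = z ++ c :: v) := by
  rcases List.append_eq_append_iff.1 h with ⟨z, hx, hz⟩ | ⟨z, hx, hz⟩
  · cases z with
    | nil => right; exact ⟨[], by simpa using hx.symm, by simpa using hz.symm⟩
    | cons d z =>
      simp only [List.cons_append, List.cons.injEq] at hz
      obtain ⟨rfl, rfl⟩ := hz
      left; exact ⟨z, hx, rfl⟩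
  · right; exact ⟨z, hx, hz⟩

theorem Dia.insert {N : ℕ} {w : List (α × Bool)} (h : Dia C N w) {K : ℕ}
    {t : List (α × Bool)} (ht : Dia C K t) :
    ∀ x y, w = x ++ y → Dia C (N + K) (x ++ t ++ y) := by
  induction h with
  | nil N =>
    intro x y hxy
    obtain ⟨rfl, rfl⟩ := List.append_eq_nil_iff.1 hxy.symm
    simpa using ht.mono (by omega)
  | br N1 N2 a u v hu hv ihu ihv =>
    intro x y hxy
    cases x with
    | nil =>
      simp only [List.nil_append] at hxy
      subst hxy
      have := ht.concat (Dia.br N1 N2 a u v hu hv)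
      simpa [add_comm] using this
    | cons b x =>
      simp only [List.cons_append, List.cons.injEq] at hxy
      obtain ⟨rfl, hxy⟩ := hxy
      rcases split1 hxy with ⟨z, rfl, rfl⟩ | ⟨z, rfl, rfl⟩
      · have := Dia.br N1 _ a u _ hu (ihv z y rfl)
        simpa [add_assoc] using this
      · have := Dia.br _ N2 a _ v (ihu x z rfl) hv
        simpa [add_assoc, add_comm, add_left_comm] using this
  | face N a s w hC h ih =>
    intro x y hxy
    cases x with
    | nil =>
      simp only [List.nil_append] at hxy
      subst hxy
      have := ht.concat (Dia.face N a s w hC h)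
      simpa [add_comm] using this
    | cons b x =>
      simp only [List.cons_append, List.cons.injEq] at hxy
      obtain ⟨rfl, rfl⟩ := hxy
      have := Dia.face _ a s (x ++ t ++ y) hC (by simpa using ih (invRev s ++ x) y (by simp))
      simpa [add_assoc, add_comm, add_left_comm] using this

/-- cyclic shift property -/
def Shift (C : Set (List (α × Bool))) (K : ℕ) : Prop :=
  ∀ x y, Dia C K (x ++ y) → Dia C K (y ++ x)

theorem shift_of_one {K : ℕ} (h : ∀ a w, Dia C K (a :: w) → Dia C K (w ++ [a])) :
    Shift C K := by
  intro x
  induction x with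
  | nil => intro y hy; simpa using hy
  | cons a x ih =>
    intro y hy
    have := ih (y ++ [a]) (by simpa using h a _ hy)
    simpa using this

theorem pos {N0 : ℕ} (hcyc : ∀ x y, x ++ y ∈ C → y ++ x ∈ C)
    (hS : ∀ K ≤ N0, Shift C K) {N : ℕ} {w : List (α × Bool)} (h : Dia C N w) :
    N ≤ N0 → ∀ x y a s, w = x ++ (invRev s ++ y) → a :: s ∈ C → Dia C (N + 1) (x ++ a :: y) := by
  induction h with
  | nil N =>
    intro _ x y a s hw hC
    obtain ⟨rfl, h2⟩ := List.append_eq_nil_iff.1 hw.symm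
    exact Dia.face N a s y hC (by rw [h2]; exact Dia.nil N)
  | br N1 N2 b u v hu hv ihu ihv =>
    intro hN x y a s hw hC
    cases x with
    | nil =>
      refine Dia.face _ a s y hC ?_
      have := Dia.br N1 N2 b u v hu hv
      rw [hw] at this
      simpa using this
    | cons b' x =>
      simp only [List.cons_append, List.cons.injEq] at hw
      obtain ⟨rfl, hw⟩ := hw
      rcases split1 hw with ⟨z, rfl, rfl⟩ | ⟨z, rfl, hw2⟩
      · have := Dia.br N1 _ b u _ hu (ihv (by omega) z y a s rfl hC)
        simpa [add_assoc] using this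
      · rcases split1 hw2.symm with ⟨z', hs, rfl⟩ | ⟨z', rfl, rfl⟩
        · have hs' : s = invRev z' ++ b :: invRev z := by
            rw [← invRev_invRev (L₁ := s), hs, invRev_append', invRev_cons', iv_iv]; simp
          subst hs'
          have hC' : b :: (invRev z ++ a :: invRev z') ∈ C := by
            have := hcyc (a :: invRev z') (b :: invRev z) (by simpa using hC)
            simpa using this
          have h1 : Dia C N1 (z ++ x) := hS N1 (by omega) x z hu
          have h2 : Dia C N1 (iv a :: ((z ++ x) ++ a :: [])) := by
            have := Dia.br N1 0 (iv a) _ [] h1 (Dia.nil 0)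
            simpa [iv_iv] using this
          have h3 := hv.insert h2 z' y rfl
          have := Dia.face (N2 + N1) b _ (x ++ a :: y) hC' (by
            simpa [invRev_append', invRev_cons'] using h3)
          simpa [add_assoc, add_comm, add_left_comm] using this
        · have := Dia.br _ N2 b _ v (ihu (by omega) x z' a s (by simp) hC) hv
          simpa [add_assoc, add_comm, add_left_comm] using this
  | face N b t w hCb h ih =>
    intro hN x y a s hw hC
    cases x with
    | nil =>
      refine Dia.face _ a s y hC ?_
      have := Dia.face N b t w hCb h
      rw [hw] at this
      simpa using this
    | cons b' x =>
      simp only [List.cons_append, List.cons.injEq] at hw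
      obtain ⟨rfl, rfl⟩ := hw
      have := ih (by omega) (invRev t ++ x) y a s (by simp) hC
      exact Dia.face _ b t _ hCb (by simpa using this)

theorem shift_all (hcyc : ∀ x y, x ++ y ∈ C → y ++ x ∈ C) (K : ℕ) : Shift C K := by
  induction K using Nat.strong_induction_on with
  | _ K IH =>
    apply shift_of_one
    intro a w h
    generalize hz : a :: w = z at h
    cases h with
    | nil N => simp at hz
    | br N1 N2 b u v hu hv =>
      obtain ⟨rfl, rfl⟩ := List.cons.inj hz
      have h2 := Dia.br N2 0 (iv a) v [] hv (Dia.nil 0)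
      have := hu.concat h2
      simpa [iv_iv] using this
    | face N b s w hC h =>
      obtain ⟨rfl, rfl⟩ := List.cons.inj hz
      have h1 := IH N (by omega) _ _ h
      exact pos (N0 := N) hcyc (fun K hK => IH K (by omega)) h1 le_rfl w [] a s (by simp) hC

theorem reduce (hcyc : ∀ x y, x ++ y ∈ C → y ++ x ∈ C) :
    ∀ N l p q (a : α × Bool), (p ++ a :: iv a :: q).length = l →
      Dia C N (p ++ a :: iv a :: q) → Dia C N (p ++ q) := by
  intro N
  induction N using Nat.strong_induction_on with
  | _ N IHN =>
  intro l
  induction l using Nat.strong_induction_on with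
  | _ l IHl =>
  have main : ∀ p q (a b : α × Bool), (b :: p ++ a :: iv a :: q).length = l →
      Dia C N (b :: p ++ a :: iv a :: q) → Dia C N (b :: p ++ q) := by
    intro p q a b hl h
    have IH : ∀ M ≤ N, ∀ p q (a : α × Bool), (p ++ a :: iv a :: q).length < l →
        Dia C M (p ++ a :: iv a :: q) → Dia C M (p ++ q) := by
      intro M hM p q a hlt hd
      rcases Nat.lt_or_ge M N with hlt' | hge
      · exact IHN M hlt' _ p q a rfl hd
      · obtain rfl : M = N := by omega
        exact IHl _ hlt p q a rfl hd
    generalize hz : b :: p ++ a :: iv a :: q = z at h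
    cases h with
    | nil N => simp at hz
    | br N1 N2 b' u v hu hv =>
      simp only [List.cons_append, List.cons.injEq] at hz
      obtain ⟨rfl, hz⟩ := hz
      have hlz := congrArg List.length hz
      simp only [List.length_append, List.length_cons] at hlz hl
      rcases split1 hz with ⟨z, rfl, hz2⟩ | ⟨z, rfl, hz2⟩
      · cases z with
        | nil =>
          simp only [List.nil_append, List.cons.injEq] at hz2
          obtain ⟨h1, rfl⟩ := hz2
          have hab : a = b := by rw [← iv_iv a, h1, iv_iv]
          subst hab
          have h2 : Dia C N1 (a :: p) := by
            have := shift_all hcyc N1 _ _ hu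
            simpa using this
          exact h2.concat hv
        | cons c z =>
          simp only [List.cons_append, List.cons.injEq] at hz2
          obtain ⟨rfl, rfl⟩ := hz2
          have h1 := IH N1 (by omega) p z a
            (by simp only [List.length_append, List.length_cons] at hl ⊢; omega) hu
          have := Dia.br N1 N2 b _ v h1 hv
          simpa using this
      · cases z with
        | nil =>
          simp only [List.nil_append, List.cons.injEq] at hz2
          obtain ⟨rfl, rfl⟩ := hz2
          rw [iv_iv] at hv
          have := hv.insert hu [b] q rfl
          simpa [add_comm] using this
        | cons c z =>
          simp only [List.cons_append, List.cons.injEq] at hz2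
          obtain ⟨rfl, rfl⟩ := hz2
          have h1 := IH N2 (by omega) z q a
            (by simp only [List.length_append, List.length_cons] at hl ⊢; omega) hv
          have := Dia.br N1 N2 b u _ hu h1
          simpa using this
    | face N b' s w hC h =>
      simp only [List.cons_append, List.cons.injEq] at hz
      obtain ⟨rfl, rfl⟩ := hz
      have := IHN N (by omega) _ (invRev s ++ p) q a rfl (by simpa using h)
      exact Dia.face N b s _ hC (by simpa using this)
  intro p q a hl h
  cases p with
  | cons b p => exact main p q a b hl h
  | nil =>
    cases q with
    | nil => exact Dia.nil N
    | cons b q =>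
      have h1 := shift_all hcyc N [a, iv a] (b :: q) (by simpa using h)
      have := main q [] a b (by simpa using hl) (by simpa using h1)
      simpa using this

theorem dia_step (hcyc : ∀ x y, x ++ y ∈ C → y ++ x ∈ C) {x y : List (α × Bool)} {N : ℕ}
    (h : Red.Step x y) : Dia C N x ↔ Dia C N y := by
  cases h with
  | @not p q a b =>
    constructor
    · intro h
      exact reduce hcyc N _ p q (a, b) rfl h
    · intro h
      have h0 : Dia C 0 [(a, b), (a, !b)] := Dia.br 0 0 (a, b) [] [] (Dia.nil 0) (Dia.nil 0)
      have := h.insert h0 p q rfl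
      simpa using this

theorem dia_red (hcyc : ∀ x y, x ++ y ∈ C → y ++ x ∈ C) {x y : List (α × Bool)} {N : ℕ}
    (h : Red x y) : Dia C N x ↔ Dia C N y := by
  induction h with
  | refl => rfl
  | tail _ h ih => exact ih.trans (dia_step hcyc h)

theorem dia_mk (hcyc : ∀ x y, x ++ y ∈ C → y ++ x ∈ C) {x y : List (α × Bool)} {N : ℕ}
    (h : FreeGroup.mk x = FreeGroup.mk y) : Dia C N x ↔ Dia C N y := by
  obtain ⟨z, hx, hy⟩ := Red.exact.1 h
  exact (dia_red hcyc hx).trans (dia_red hcyc hy).symm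

theorem dia_rel (hcyc : ∀ x y, x ++ y ∈ C → y ++ x ∈ C) {r : List (α × Bool)} (hr : r ∈ C) :
    Dia C 1 r := by
  cases r with
  | nil => exact Dia.nil 1
  | cons a s =>
    refine Dia.face 0 a s s hr ?_
    refine (dia_mk hcyc (y := []) ?_).2 (Dia.nil 0)
    rw [← mul_mk, ← inv_mk, inv_mul_cancel]; rfl

theorem dia_conj (hcyc : ∀ x y, x ++ y ∈ C → y ++ x ∈ C) {r x : List (α × Bool)} (hr : r ∈ C) :
    Dia C 1 (invRev x ++ r ++ x) := by
  have h0 : Dia C 0 (invRev x ++ x) := by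
    refine (dia_mk hcyc (y := []) ?_).2 (Dia.nil 0)
    rw [← mul_mk, ← inv_mk, inv_mul_cancel]; rfl
  simpa using h0.insert (dia_rel hcyc hr) _ _ rfl

theorem dia_prod (hcyc : ∀ x y, x ++ y ∈ C → y ++ x ∈ C)
    (L : List (List (α × Bool) × List (α × Bool))) (hL : ∀ p ∈ L, p.1 ∈ C) :
    ∃ w, Dia C L.length w ∧ FreeGroup.mk w = (L.map fun p =>
        (FreeGroup.mk p.2)⁻¹ * FreeGroup.mk p.1 * FreeGroup.mk p.2).prod := by
  induction L with
  | nil => exact ⟨[], Dia.nil _, rfl⟩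
  | cons p L ih =>
    obtain ⟨w, hw, he⟩ := ih (fun q hq => hL q (by simp [hq]))
    refine ⟨(invRev p.2 ++ p.1 ++ p.2) ++ w, ?_, ?_⟩
    · have := (dia_conj hcyc (x := p.2) (hL p (by simp))).concat hw
      simpa [add_comm] using this
    · rw [List.map_cons, List.prod_cons, ← he, ← mul_mk, ← mul_mk, ← mul_mk, inv_mk]

section
variable (R : Finset (List (α × Bool)))

/-- signed relator -/
def SR (r : List (α × Bool)) : Prop := r ∈ R ∨ invRev r ∈ R

/-- cyclic conjugates of signed relators -/
def Cyc : Set (List (α × Bool)) := {r | ∃ x y, r = y ++ x ∧ SR R (x ++ y)}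

theorem cyc_cyc : ∀ x y, x ++ y ∈ Cyc R → y ++ x ∈ Cyc R := by
  rintro x y ⟨s, t, h, hR⟩
  rcases List.append_eq_append_iff.1 h with ⟨z, rfl, rfl⟩ | ⟨z, rfl, rfl⟩
  · exact ⟨s ++ x, z, by simp, by simpa using hR⟩
  · exact ⟨z, y ++ t, by simp, by simpa using hR⟩

/-- bounded rewriting -/
def St (B : ℕ) (x y : List (α × Bool)) : Prop := RwStep R x y ∧ x.length ≤ B ∧ y.length ≤ B

/-- reachability -/
def Re (B : ℕ) : List (α × Bool) → List (α × Bool) → Prop := Relation.ReflTransGen (St R B)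

variable {R}

theorem Re.mono {B B' : ℕ} (hB : B ≤ B') {x y : List (α × Bool)} (h : Re R B x y) :
    Re R B' x y := by
  induction h with
  | refl => exact Relation.ReflTransGen.refl
  | tail _ h ih => exact ih.tail ⟨h.1, h.2.1.trans hB, h.2.2.trans hB⟩

theorem RwStep.ctx {x y : List (α × Bool)} (h : RwStep R x y) (s t : List (α × Bool)) :
    RwStep R (s ++ x ++ t) (s ++ y ++ t) := by
  rcases h with ⟨p, u, v, q, rfl, rfl, h⟩ | ⟨p, q, a, b, ⟨rfl, rfl⟩ | ⟨rfl, rfl⟩⟩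
  · exact Or.inl ⟨s ++ p, u, v, q ++ t, by simp, by simp, h⟩
  · exact Or.inr ⟨s ++ p, q ++ t, a, b, Or.inl ⟨by simp, by simp⟩⟩
  · exact Or.inr ⟨s ++ p, q ++ t, a, b, Or.inr ⟨by simp, by simp⟩⟩

theorem Re.ctx {B : ℕ} {x y : List (α × Bool)} (h : Re R B x y) (s t : List (α × Bool)) :
    Re R (s.length + B + t.length) (s ++ x ++ t) (s ++ y ++ t) := by
  induction h with
  | refl => exact Relation.ReflTransGen.refl
  | tail _ h ih =>
    refine ih.tail ⟨RwStep.ctx h.1 s t, ?_, ?_⟩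
    · have := h.2.1; simp only [List.length_append]; omega
    · have := h.2.2; simp only [List.length_append]; omega

/-- Insert `z z⁻¹`. -/
theorem re_insert (z : List (α × Bool)) : Re R (2 * z.length) [] (z ++ invRev z) := by
  induction z with
  | nil => exact Relation.ReflTransGen.refl
  | cons a z ih =>
    have h1 : St R (2 * (a :: z).length) [] [a, iv a] := by
      refine ⟨Or.inr ⟨[], [], a.1, a.2, Or.inl ⟨rfl, rfl⟩⟩, by simp, ?_⟩
      simp only [List.length_cons, List.length_nil]; omega
    have h2 := (ih.ctx [a] [iv a]).mono (B' := 2 * (a :: z).length) (by simp; omega)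
    have h3 := Relation.ReflTransGen.head h1 h2
    simpa [Re, invRev_cons'] using h3

theorem dia_re (M : ℕ) (hM : ∀ r ∈ Cyc R, r.length ≤ M) {N : ℕ} {w : List (α × Bool)}
    (h : Dia (Cyc R) N w) : Re R (w.length + 2 * M * N) w [] := by
  induction h with
  | nil N => exact Relation.ReflTransGen.refl
  | br N1 N2 a u v hu hv ihu ihv =>
    set B := (a :: (u ++ iv a :: v)).length + 2 * M * (N1 + N2) with hBdef
    have hB : B = u.length + v.length + 2 + 2 * M * N1 + 2 * M * N2 := by
      rw [hBdef]; simp only [List.length_cons, List.length_append]; ring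
    have h1 := (ihu.ctx [a] (iv a :: v)).mono (B' := B) (by
      simp only [List.length_cons, List.length_nil]; omega)
    have h2 : St R B (a :: iv a :: v) v := by
      refine ⟨Or.inr ⟨[], v, a.1, a.2, Or.inr ⟨rfl, rfl⟩⟩, ?_, ?_⟩
      · simp only [List.length_cons]; omega
      · omega
    have h3 := ihv.mono (B' := B) (by omega)
    have h4 : Re R B (a :: (u ++ iv a :: v)) (a :: iv a :: v) := by simpa using h1
    exact h4.trans (Relation.ReflTransGen.head h2 h3)
  | face N a s w hC h ih =>
    have hl := hM _ hC
    set B := (a :: w).length + 2 * M * (N + 1) with hBdef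
    have hB : B = w.length + 1 + 2 * M * N + 2 * M := by
      rw [hBdef]; simp only [List.length_cons]; ring
    simp only [List.length_cons] at hl
    have ih' := ih.mono (B' := B) (by
      simp only [List.length_append, invRev_length]; omega)
    refine Relation.ReflTransGen.trans ?_ ih'
    obtain ⟨x, y, hxy, hR⟩ := hC
    have key : ∃ r1 t, s = t ++ r1 ∧ SR R (r1 ++ a :: t) := by
      cases y with
      | nil =>
        refine ⟨[], s, by simp, ?_⟩
        simp only [List.nil_append] at hxy
        rw [List.append_nil, ← hxy] at hR
        simpa using hR
      | cons b y =>
        obtain ⟨rfl, rfl⟩ := List.cons.inj hxy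
        exact ⟨x, y, rfl, hR⟩
    obtain ⟨r1, t, rfl, hR⟩ := key
    simp only [List.length_append] at hl
    have e1 := ((re_insert (R := R) t).ctx [a] w).mono (B' := B) (by simp; omega)
    have e2 := ((re_insert (R := R) (invRev r1)).ctx [] (a :: t ++ invRev t ++ w)).mono
      (B' := B) (by simp; omega)
    have e3 : St R B (invRev r1 ++ (r1 ++ a :: t) ++ (invRev t ++ w))
        (invRev r1 ++ [] ++ (invRev t ++ w)) := by
      refine ⟨Or.inl ⟨_, r1 ++ a :: t, [], _, rfl, rfl, by simpa [SR] using hR⟩, ?_, ?_⟩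
      · simp; omega
      · simp; omega
    have e1' : Re R B (a :: w) (a :: t ++ invRev t ++ w) := by simpa using e1
    have e2' : Re R B (a :: t ++ invRev t ++ w)
      (invRev r1 ++ (r1 ++ a :: t) ++ (invRev t ++ w)) := by simpa using e2
    have e3' := e1'.trans (e2'.tail e3)
    simpa [invRev_append', Re] using e3'

theorem re_seq {B : ℕ} {w : List (α × Bool)} (h : Re R B w []) : RwSeqTo1 R B w := by
  induction h using Relation.ReflTransGen.head_induction_on with
  | refl => exact ⟨[], List.isChain_singleton _, rfl, by simp⟩
  | @head x y h _ ih =>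
    obtain ⟨ws, h1, h2, h3⟩ := ih
    refine ⟨y :: ws, ?_, ?_, ?_⟩
    · exact List.isChain_cons_cons.2 ⟨h.1, h1⟩
    · rw [List.getLast_cons (List.cons_ne_nil y ws)]; exact h2
    · intro v hv
      rcases List.mem_cons.1 hv with rfl | hv
      · exact h.2.1
      · exact h3 v hv

/-- the product of conjugates -/
def PC (L : List (List (α × Bool) × List (α × Bool))) : FreeGroup α :=
  (L.map fun p => (FreeGroup.mk p.2)⁻¹ * FreeGroup.mk p.1 * FreeGroup.mk p.2).prod

theorem seq_prod {B : ℕ} (ws : List (List (α × Bool))) : ∀ w,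
    List.IsChain (RwStep R) (w :: ws) → (w :: ws).getLast (List.cons_ne_nil w ws) = [] →
    (∀ v ∈ w :: ws, v.length ≤ B) →
    ∃ L : List (List (α × Bool) × List (α × Bool)),
      (∀ p ∈ L, (p.1 ∈ R ∨ invRev p.1 ∈ R) ∧ p.2.length ≤ B / 2) ∧
      FreeGroup.mk w = PC L := by
  induction ws with
  | nil =>
    intro w _ h2 _
    have h2' : w = [] := h2
    subst h2'
    exact ⟨[], by simp, rfl⟩
  | cons y ws ih =>
    intro x h1 h2 h3
    obtain ⟨hs, h1⟩ := List.isChain_cons_cons.1 h1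
    obtain ⟨L, hL, he⟩ := ih y h1 (by rwa [List.getLast_cons (List.cons_ne_nil y ws)] at h2)
      (fun v hv => h3 v (List.mem_cons_of_mem _ hv))
    have hy : y.length ≤ B := h3 y (by simp)
    rcases hs with ⟨p, u, v, q, rfl, rfl, h⟩ | ⟨p, q, a, b, ⟨rfl, rfl⟩ | ⟨rfl, rfl⟩⟩
    · simp only [List.length_append] at hy
      by_cases hp : 2 * p.length ≤ B
      · refine ⟨(u ++ invRev v, invRev p) :: L, ?_, ?_⟩
        · intro z hz
          rcases List.mem_cons.1 hz with rfl | hz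
          · exact ⟨h, by simp only [invRev_length]; omega⟩
          · exact hL z hz
        · unfold PC at he ⊢
          rw [List.map_cons, List.prod_cons, ← he]
          simp only [← mul_mk, ← inv_mk]
          group
      · refine ⟨L ++ [(u ++ invRev v, v ++ q)], ?_, ?_⟩
        · intro z hz
          rcases List.mem_append.1 hz with hz | hz
          · exact hL z hz
          · obtain rfl := List.mem_singleton.1 hz
            exact ⟨h, by simp only [List.length_append]; omega⟩
        · unfold PC at he ⊢
          rw [List.map_append, List.prod_append, ← he]
          simp only [← mul_mk, ← inv_mk, List.map_cons, List.map_nil, List.prod_cons,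
            List.prod_nil]
          group
    · exact ⟨L, hL, by rw [← he]; exact (Quot.sound Red.Step.not).symm⟩
    · exact ⟨L, hL, by rw [← he]; exact (Quot.sound Red.Step.not)⟩

theorem triv_prod {w : List (α × Bool)} (h : WordTrivial R w) :
    ∃ L : List (List (α × Bool) × List (α × Bool)),
      (∀ p ∈ L, p.1 ∈ R ∨ invRev p.1 ∈ R) ∧ FreeGroup.mk w = PC L := by
  unfold WordTrivial Subgroup.normalClosure at h
  rw [← Subgroup.mem_toSubmonoid, Subgroup.closure_toSubmonoid] at h
  obtain ⟨l, hl, he⟩ := Submonoid.exists_list_of_mem_closure h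
  rw [← he]
  clear he h
  have key : ∀ y : FreeGroup α, y ∈ Group.conjugatesOfSet
      (FreeGroup.mk '' (R : Set (List (α × Bool)))) →
      ∃ r x : List (α × Bool), r ∈ R ∧
        y = (FreeGroup.mk x)⁻¹ * FreeGroup.mk r * FreeGroup.mk x := by
    intro y hy
    obtain ⟨g, ⟨r, hr, rfl⟩, hc⟩ := Group.mem_conjugatesOfSet_iff.1 hy
    obtain ⟨c, rfl⟩ := isConj_iff.1 hc
    classical
    refine ⟨r, (c⁻¹).toWord, hr, ?_⟩
    rw [FreeGroup.mk_toWord, inv_inv]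
  induction l with
  | nil => exact ⟨[], by simp, rfl⟩
  | cons y l ih =>
    obtain ⟨L, hL, he⟩ := ih (fun z hz => hl z (List.mem_cons_of_mem _ hz))
    rcases hl y (by simp) with hy | hy
    · obtain ⟨r, x, hr, hyx⟩ := key y hy
      refine ⟨(r, x) :: L, ?_, ?_⟩
      · intro z hz
        rcases List.mem_cons.1 hz with rfl | hz
        · exact Or.inl hr
        · exact hL z hz
      · rw [List.prod_cons, he, hyx]; simp [PC]
    · obtain ⟨r, x, hr, hyx⟩ := key _ hy
      refine ⟨(invRev r, x) :: L, ?_, ?_⟩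
      · intro z hz
        rcases List.mem_cons.1 hz with rfl | hz
        · exact Or.inr (by simpa using hr)
        · exact hL z hz
      · have : y = (FreeGroup.mk x)⁻¹ * (FreeGroup.mk r)⁻¹ * FreeGroup.mk x := by
          rw [← inv_inv y, hyx]; group
        rw [List.prod_cons, he, this]; simp [PC]

end

end FillingProof

open FillingProof in
theorem stmt19 {α : Type} [Fintype α] [DecidableEq α]
    (R : Finset (List (α × Bool))) (hr : ∀ r ∈ R, r ≠ []) :
    (∀ n, 2 * Dmin R n ≤ Fmin R n) ∧
      ∃ c : ℕ, 1 < c ∧ ∀ n, Fmin R n ≤ c * (Pmin R n + n) := by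
  obtain ⟨M, hM⟩ : ∃ M : ℕ, ∀ r ∈ Cyc R, r.length ≤ M := by
    refine ⟨R.sup List.length, ?_⟩
    rintro r ⟨x, y, rfl, h⟩
    have : (y ++ x).length = (x ++ y).length := by simp [add_comm]
    rw [this]
    rcases h with h | h
    · exact Finset.le_sup (f := List.length) h
    · rw [← FreeGroup.invRev_length]
      exact Finset.le_sup (f := List.length) h
  have hP : ∀ n, ∀ w : List (α × Bool), w.length ≤ n → WordTrivial R w →
    ∃ L : List (List (α × Bool) × List (α × Bool)),
      (∀ p ∈ L, p.1 ∈ R ∨ FreeGroup.invRev p.1 ∈ R) ∧ L.length ≤ Pmin R n ∧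
      FreeGroup.mk w = (L.map fun p =>
        (FreeGroup.mk p.2)⁻¹ * FreeGroup.mk p.1 * FreeGroup.mk p.2).prod := by
    intro n
    refine Nat.sInf_mem (s := {N | ∀ w : List (α × Bool), w.length ≤ n → WordTrivial R w →
      ∃ L : List (List (α × Bool) × List (α × Bool)),
      (∀ p ∈ L, p.1 ∈ R ∨ FreeGroup.invRev p.1 ∈ R) ∧ L.length ≤ N ∧
      FreeGroup.mk w = (L.map fun p =>
        (FreeGroup.mk p.2)⁻¹ * FreeGroup.mk p.1 * FreeGroup.mk p.2).prod}) ?_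
    have hex : ∀ w : List (α × Bool), ∃ L : List (List (α × Bool) × List (α × Bool)),
        WordTrivial R w → (∀ p ∈ L, p.1 ∈ R ∨ FreeGroup.invRev p.1 ∈ R) ∧
          FreeGroup.mk w = PC L := by
      intro w
      by_cases h : WordTrivial R w
      · obtain ⟨L, hL⟩ := triv_prod h
        exact ⟨L, fun _ => hL⟩
      · exact ⟨[], fun h' => absurd h' h⟩
    choose f hf using hex
    have hfin : {w : List (α × Bool) | w.length ≤ n}.Finite := List.finite_length_le _ n
    refine ⟨hfin.toFinset.sup (fun w => (f w).length), ?_⟩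
    intro w hw ht
    refine ⟨f w, (hf w ht).1, ?_, (hf w ht).2⟩
    exact Finset.le_sup (f := fun w => (f w).length) (hfin.mem_toFinset.2 hw)
  have hF : ∀ n, n + 2 * M * Pmin R n ∈ {L | ∀ w : List (α × Bool), w.length ≤ n →
      WordTrivial R w → RwSeqTo1 R L w} := by
    intro n w hw ht
    obtain ⟨L, hL, hlen, he⟩ := hP n w hw ht
    obtain ⟨w', hd, he'⟩ := dia_prod (C := Cyc R) (cyc_cyc R) L
      (fun p hp => ⟨p.1, [], by simp, by simpa [SR] using hL p hp⟩)
    have hd2 := ((dia_mk (cyc_cyc R) (he.trans he'.symm)).2 hd).mono hlen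
    exact re_seq ((dia_re M hM hd2).mono (by omega))
  refine ⟨?_, 2 * M + 2, by omega, ?_⟩
  · intro n
    have hmem : Fmin R n ∈ {L | ∀ w : List (α × Bool), w.length ≤ n →
      WordTrivial R w → RwSeqTo1 R L w} := Nat.sInf_mem ⟨_, hF n⟩
    have : Dmin R n ≤ Fmin R n / 2 := by
      refine Nat.sInf_le ?_
      intro w hw ht
      obtain ⟨ws, h1, h2, h3⟩ := hmem w hw ht
      exact seq_prod ws w h1 h2 h3
    omega
  · intro n
    have h1 : Fmin R n ≤ n + 2 * M * Pmin R n := Nat.sInf_le (hF n)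
    nlinarith [Nat.zero_le (M * n), Nat.zero_le (Pmin R n)]
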